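/- For every a < 0 with Ai(a) = 0 and every x ≥ a, one has |Ai'(x)| ≤ |Ai'(a)|; that is, on the half-line to the right of any zero of Ai, the absolute value of the derivative Ai' is maximized at that zero. -/

import Mathlib

open MeasureTheory Filter Set

/-- The Airy function of the first kind, defined as
`Ai(x) = (1/π) · lim_{R→∞} ∫₀^R cos(t³/3 + x·t) dt`. -/
noncomputable def Ai (x : ℝ) : ℝ :=
  (1 / Real.pi) *
    limUnder Filter.atTop (fun R : ℝ => ∫ t in (0:ℝ)..R, Real.cos (t ^ 3 / 3 + x * t))

/-- analytic integrand -/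
noncomputable def aiF (x : ℝ) (z : ℂ) : ℂ := Complex.exp (Complex.I * (z ^ 3 / 3 + x * z))

/-- multiplier -/
noncomputable def aiM (t : ℝ) : ℂ := Complex.I * (t + Complex.I)

/-- k-th derivative integrand -/
noncomputable def aiK (k : ℕ) (x t : ℝ) : ℂ := aiM t ^ k * aiF x (t + Complex.I)

noncomputable def aiH (k : ℕ) (x : ℝ) : ℂ := ∫ t in Ioi (0:ℝ), aiK k x t

lemma aiF_norm (x R s : ℝ) : ‖aiF x (R + s * Complex.I)‖ = Real.exp (-(R^2*s) + s^3/3 - x*s) := by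
  unfold aiF
  rw [Complex.norm_exp]
  congr 1
  have : Complex.I * (((R:ℂ) + s * Complex.I)^3/3 + x * (R + s*Complex.I))
     = ((-(R^2*s) + s^3/3 - x*s : ℝ) : ℂ) + ((R^3/3 - R*s^2 + x*R : ℝ):ℂ) * Complex.I := by
    push_cast
    linear_combination ((R:ℂ)^2*s +x*s + s^3 /3 * (Complex.I^2 - 1) + R * s^2 * Complex.I) * Complex.I_sq
  rw [this, Complex.add_re, Complex.ofReal_re, Complex.re_ofReal_mul, Complex.I_re, mul_zero, add_zero]

lemma aiF_norm1 (x t : ℝ) : ‖aiF x (t + Complex.I)‖ = Real.exp (1/3 - x - t^2) := by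
  have := aiF_norm x t 1
  simp only [Complex.ofReal_one, one_mul] at this
  rw [this]; congr 1; ring

lemma aiM_norm (t : ℝ) (ht : 0 ≤ t) : ‖aiM t‖ ≤ Real.exp t := by
  unfold aiM
  rw [norm_mul, Complex.norm_I, one_mul]
  refine (norm_add_le _ _).trans ?_
  rw [Complex.norm_I, Complex.norm_real, Real.norm_of_nonneg ht]
  exact Real.add_one_le_exp t

lemma aiK_bound (k : ℕ) (x t : ℝ) (ht : 0 ≤ t) :
    ‖aiK k x t‖ ≤ Real.exp (1/3 - x + (k:ℝ)^2/2) * Real.exp (-(1/2) * t^2) := by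
  unfold aiK
  rw [norm_mul, norm_pow, aiF_norm1]
  calc _ ≤ Real.exp t ^ k * Real.exp (1/3 - x - t^2) := by
        gcongr; exact aiM_norm t ht
    _ ≤ _ := by
        rw [← Real.exp_nat_mul, ← Real.exp_add, ← Real.exp_add]
        apply Real.exp_le_exp.2
        nlinarith [sq_nonneg ((k:ℝ) - t)]

lemma aiK_cont (k : ℕ) (x : ℝ) : Continuous (aiK k x) := by
  unfold aiK aiM aiF; fun_prop

lemma gauss_int (C : ℝ) : IntegrableOn (fun t : ℝ => C * Real.exp (-(1/2) * t^2)) (Ioi 0) :=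
  ((integrable_exp_neg_mul_sq (by norm_num)).const_mul C).integrableOn

lemma aiK_int (k : ℕ) (x : ℝ) : IntegrableOn (aiK k x) (Ioi 0) := by
  refine Integrable.mono' (gauss_int (Real.exp (1/3 - x + (k:ℝ)^2/2)))
    (aiK_cont k x).aestronglyMeasurable ?_
  filter_upwards [ae_restrict_mem measurableSet_Ioi] with t ht
  exact aiK_bound k x t (le_of_lt ht)

lemma aiK_deriv (k : ℕ) (x t : ℝ) : HasDerivAt (fun y => aiK k y t) (aiK (k+1) x t) x := by
  unfold aiK aiF
  have h1 : HasDerivAt (fun y : ℝ => (y:ℂ)) 1 x := Complex.ofRealCLM.hasDerivAt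
  have h2 := ((((h1.mul_const ((t:ℂ) + Complex.I)).const_add (((t:ℂ) + Complex.I)^3/3)).const_mul
    Complex.I).cexp).const_mul (aiM t ^ k)
  refine h2.congr_deriv ?_
  unfold aiM
  ring

lemma aiH_deriv (k : ℕ) (x : ℝ) : HasDerivAt (aiH k) (aiH (k+1) x) x := by
  unfold aiH
  refine (hasDerivAt_integral_of_dominated_loc_of_deriv_le (F := aiK k)
    (F' := aiK (k+1)) (bound := fun t => Real.exp (1/3 - (x-1) + ((k+1:ℕ):ℝ)^2/2) * Real.exp (-(1/2) * t^2))
    (s := Metric.ball x 1) (Metric.ball_mem_nhds x one_pos) ?_ (aiK_int k x) ?_ ?_ (gauss_int _) ?_).2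
  · exact Eventually.of_forall fun y => (aiK_cont k y).aestronglyMeasurable
  · exact (aiK_cont _ x).aestronglyMeasurable
  · filter_upwards [ae_restrict_mem measurableSet_Ioi] with t ht y hy
    refine (aiK_bound _ y t (le_of_lt ht)).trans ?_
    rw [Metric.mem_ball, Real.dist_eq, abs_lt] at hy
    gcongr
    linarith
  · exact Eventually.of_forall fun t y _ => aiK_deriv k y t

lemma aiF_tderiv (x t : ℝ) : HasDerivAt (fun t : ℝ => Complex.I * aiF x (t + Complex.I))
    (aiK 2 x t - x * aiK 0 x t) t := by
  unfold aiK aiF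
  have h1 : HasDerivAt (fun y : ℝ => (y:ℂ)) 1 t := Complex.ofRealCLM.hasDerivAt
  have h0 := h1.add_const Complex.I
  have h2 := (((((h0.pow 3).div_const 3).add (h0.const_mul (x:ℂ))).const_mul
    Complex.I).cexp).const_mul Complex.I
  refine h2.congr_deriv ?_
  unfold aiM
  simp
  linear_combination (x * Complex.exp (Complex.I * (((t:ℂ) + Complex.I)^3/3 + x * (t + Complex.I)))) * Complex.I_sq

lemma aiH_ode (x : ℝ) : aiH 2 x - x * aiH 0 x = -(Complex.I * aiF x Complex.I) := by
  have hlim : Tendsto (fun t : ℝ => Complex.I * aiF x (t + Complex.I)) atTop (nhds 0) := by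
    rw [tendsto_zero_iff_norm_tendsto_zero]
    simp only [norm_mul, Complex.norm_I, one_mul, aiF_norm1]
    apply Real.tendsto_exp_atBot.comp
    have : Tendsto (fun t : ℝ => t^2) atTop atTop := tendsto_pow_atTop (by norm_num)
    exact tendsto_atBot_add_const_left _ (1/3 - x) (tendsto_neg_atTop_atBot.comp this)
  have hi : IntegrableOn (fun t => aiK 2 x t - x * aiK 0 x t) (Ioi 0) :=
    (aiK_int 2 x).sub ((aiK_int 0 x).const_mul _)
  have := integral_Ioi_of_hasDerivAt_of_tendsto' (a := 0) (fun t _ => aiF_tderiv x t) hi hlim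
  rw [integral_sub (aiK_int 2 x) ((aiK_int 0 x).const_mul _), integral_const_mul] at this
  simpa [aiH] using this

lemma aiF_im_axis (x s : ℝ) : aiF x (s * Complex.I) = (Real.exp (s^3/3 - x*s) : ℝ) := by
  unfold aiF
  rw [Complex.ofReal_exp]
  congr 1
  push_cast
  linear_combination (x * s + s^3/3 * (Complex.I^2 - 1)) * Complex.I_sq

lemma aiH_ode_re (x : ℝ) : (aiH 2 x).re = x * (aiH 0 x).re := by
  have h := congrArg Complex.re (aiH_ode x)
  have h1 := aiF_im_axis x 1
  simp only [Complex.ofReal_one, one_mul] at h1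
  rw [h1, Complex.neg_re, mul_comm Complex.I, Complex.re_ofReal_mul, Complex.sub_re, Complex.re_ofReal_mul, Complex.I_re] at h
  linarith

lemma aiF_rect (x R : ℝ) : (∫ t in (0:ℝ)..R, Real.cos (t ^ 3 / 3 + x * t)) =
    (∫ t in (0:ℝ)..R, aiK 0 x t).re
      - (Complex.I * ∫ s in (0:ℝ)..1, aiF x (R + s * Complex.I)).re := by
  have hd : Differentiable ℂ (aiF x) := by unfold aiF; fun_prop
  have h := Complex.integral_boundary_rect_eq_zero_of_differentiableOn (aiF x) 0 (R + Complex.I)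
    hd.differentiableOn
  simp at h
  have h1 : (∫ t in (0:ℝ)..R, Real.cos (t ^ 3 / 3 + x * t)) = (∫ t in (0:ℝ)..R, aiF x t).re := by
    have hc : Continuous (fun t : ℝ => aiF x t) := by unfold aiF; fun_prop
    have := Complex.reCLM.intervalIntegral_comp_comm (hc.intervalIntegrable (μ := volume) 0 R)
    simp only [Complex.reCLM_apply] at this
    rw [← this]
    congr 1; ext t
    unfold aiF
    rw [mul_comm Complex.I, show ((t:ℂ)^3/3 + x * t) = ((t^3/3+x*t : ℝ):ℂ) by push_cast; ring,
      Complex.exp_ofReal_mul_I_re]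
  have h2 : (∫ s in (0:ℝ)..1, aiF x (s * Complex.I)) =
      ((∫ s in (0:ℝ)..1, Real.exp (s^3/3 - x*s) : ℝ) : ℂ) := by
    rw [← intervalIntegral.integral_ofReal]
    congr 1; ext s; exact aiF_im_axis x s
  rw [h2] at h
  have h' := congrArg Complex.re h
  simp at h'
  rw [h1]
  simp [aiK]
  linarith

lemma aiF_side (x : ℝ) : Tendsto (fun R : ℝ => ∫ s in (0:ℝ)..1, aiF x (R + s * Complex.I))
    atTop (nhds 0) := by
  have : Tendsto (fun R : ℝ => ∫ s in (0:ℝ)..1, aiF x (R + s * Complex.I))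
    atTop (nhds (∫ s in (0:ℝ)..1, (0:ℂ))) := by
    refine intervalIntegral.tendsto_integral_filter_of_dominated_convergence
      (fun _ => Real.exp (1/3 + |x|)) ?_ ?_ (by simp) ?_
    · refine Eventually.of_forall fun R => Continuous.aestronglyMeasurable ?_
      unfold aiF; fun_prop
    · refine Eventually.of_forall fun R => Eventually.of_forall fun s hs => ?_
      rw [uIoc_of_le zero_le_one] at hs
      rw [aiF_norm]
      apply Real.exp_le_exp.2
      have h1 : s^3 ≤ 1 := pow_le_one₀ hs.1.le hs.2
      have h2 : -(x*s) ≤ |x| := by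
        calc -(x*s) ≤ |x*s| := neg_le_abs _
          _ = |x| * s := by rw [abs_mul, abs_of_pos hs.1]
          _ ≤ |x| * 1 := by gcongr; exact hs.2
          _ = _ := mul_one _
      have h3 : 0 ≤ R^2*s := mul_nonneg (sq_nonneg _) hs.1.le
      linarith
    · refine Eventually.of_forall fun s hs => ?_
      rw [uIoc_of_le zero_le_one] at hs
      rw [tendsto_zero_iff_norm_tendsto_zero]
      simp only [aiF_norm]
      apply Real.tendsto_exp_atBot.comp
      have h : Tendsto (fun t : ℝ => t^2*s) atTop atTop :=
        (tendsto_pow_atTop (by norm_num)).atTop_mul_const hs.1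
      have := tendsto_atBot_add_const_right _ (s^3/3 - x*s) (tendsto_neg_atTop_atBot.comp h)
      refine this.congr fun R => ?_
      simp; ring
  simpa using this

lemma Ai_eq (x : ℝ) : Ai x = (1/Real.pi) * (aiH 0 x).re := by
  unfold Ai
  congr 1
  apply Tendsto.limUnder_eq
  have h1 : Tendsto (fun R : ℝ => ∫ t in (0:ℝ)..R, aiK 0 x t) atTop (nhds (aiH 0 x)) :=
    intervalIntegral_tendsto_integral_Ioi 0 (aiK_int 0 x) tendsto_id
  have h2 := (Complex.continuous_re.tendsto _).comp h1
  have h3 := (Complex.continuous_re.tendsto _).comp ((aiF_side x).const_mul Complex.I)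
  have := h2.sub h3
  simp only [mul_zero, Complex.zero_re, sub_zero] at this
  exact this.congr fun R => (aiF_rect x R).symm

lemma aiRe_deriv (k : ℕ) (x : ℝ) : HasDerivAt (fun y => (1/Real.pi) * (aiH k y).re)
    ((1/Real.pi) * (aiH (k+1) x).re) x :=
  ((Complex.reCLM.hasFDerivAt.comp_hasDerivAt x (aiH_deriv k x))).const_mul (1/Real.pi)

lemma Ai_deriv (x : ℝ) : HasDerivAt Ai (deriv Ai x) x := by
  have : HasDerivAt Ai ((1/Real.pi) * (aiH 1 x).re) x := by rw [funext Ai_eq]; exact aiRe_deriv 0 x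
  exact this.differentiableAt.hasDerivAt

lemma Ai_deriv2 (x : ℝ) : HasDerivAt (deriv Ai) (x * Ai x) x := by
  have h : deriv Ai = fun y => (1/Real.pi) * (aiH 1 y).re := by
    ext y
    rw [funext Ai_eq]
    exact (aiRe_deriv 0 y).deriv
  rw [h, Ai_eq]
  have := aiRe_deriv 1 x
  rw [show 1 + 1 = 2 from rfl, aiH_ode_re] at this
  convert this using 1
  ring

lemma Ai_bdd : ∃ C : ℝ, ∀ x : ℝ, 0 ≤ x → Ai x ^ 2 ≤ C := by
  refine ⟨((1/Real.pi) * ∫ t in Ioi (0:ℝ), Real.exp (1/3) * Real.exp (-(1/2) * t^2))^2, fun x hx => ?_⟩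
  rw [← sq_abs, Ai_eq, abs_mul, abs_of_pos (by positivity)]
  gcongr
  refine (Complex.abs_re_le_norm _).trans ?_
  refine norm_integral_le_of_norm_le (gauss_int _) ?_
  filter_upwards [ae_restrict_mem measurableSet_Ioi] with t ht
  refine (aiK_bound 0 x t (le_of_lt ht)).trans ?_
  gcongr
  simp; exact hx

lemma AiAi'_nonpos (x : ℝ) (hx : 0 ≤ x) : Ai x * deriv Ai x ≤ 0 := by
  by_contra! hc
  obtain ⟨C, hC⟩ := Ai_bdd
  have hmono : MonotoneOn (fun y => Ai y * deriv Ai y) (Ici 0) := by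
    have hd : ∀ y, HasDerivAt (fun y => Ai y * deriv Ai y) (deriv Ai y * deriv Ai y + Ai y * (y * Ai y)) y :=
      fun y => (Ai_deriv y).mul (Ai_deriv2 y)
    refine monotoneOn_of_deriv_nonneg (convex_Ici 0)
      (fun y _ => (hd y).continuousAt.continuousWithinAt)
      (fun y _ => (hd y).differentiableAt.differentiableWithinAt) fun y hy => ?_
    rw [interior_Ici] at hy
    rw [(hd y).deriv]
    have : 0 ≤ y * (Ai y * Ai y) := mul_nonneg (le_of_lt hy) (mul_self_nonneg _)
    nlinarith [mul_self_nonneg (deriv Ai y)]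
  set c := Ai x * deriv Ai x with hcdef
  have hd2 : ∀ y, HasDerivAt (fun y => Ai y ^ 2 - 2 * c * y) (2 * (Ai y * deriv Ai y) - 2 * c) y := by
    intro y
    have := ((Ai_deriv y).pow 2).sub ((hasDerivAt_id y).const_mul (2*c))
    refine this.congr_deriv ?_
    simp; ring
  have hm2 : MonotoneOn (fun y => Ai y ^ 2 - 2 * c * y) (Ici x) := by
    refine monotoneOn_of_deriv_nonneg (convex_Ici x)
      (fun y _ => (hd2 y).continuousAt.continuousWithinAt)
      (fun y _ => (hd2 y).differentiableAt.differentiableWithinAt) fun y hy => ?_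
    rw [interior_Ici] at hy
    rw [(hd2 y).deriv]
    have := hmono (show x ∈ Ici 0 from hx) (show y ∈ Ici 0 from hx.trans (le_of_lt hy)) (le_of_lt hy)
    simp only at this
    linarith
  have hCnn : 0 ≤ C := (sq_nonneg _).trans (hC 0 le_rfl)
  have hp : 0 ≤ (C+1)/(2*c) := by positivity
  have := hm2 (show x ∈ Ici x from self_mem_Ici) (show x + (C+1)/(2*c) ∈ Ici x by simpa using hp) (by linarith)
  simp only at this
  have h4 := hC (x + (C+1)/(2*c)) (by linarith)
  have h5 : 2 * c * ((C+1)/(2*c)) = C + 1 := by field_simp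
  nlinarith [sq_nonneg (Ai x)]

lemma Ai'_left (a x : ℝ) (hzero : Ai a = 0) (hax : a ≤ x) (hx : x ≤ 0) :
    deriv Ai x ^ 2 ≤ deriv Ai a ^ 2 := by
  have hd : ∀ y, HasDerivAt (fun y => deriv Ai y ^ 2 - y * Ai y ^ 2) (-(Ai y ^ 2)) y := by
    intro y
    have := ((Ai_deriv2 y).pow 2).sub ((hasDerivAt_id y).mul ((Ai_deriv y).pow 2))
    refine this.congr_deriv ?_
    simp; ring
  have hm : Antitone (fun y => deriv Ai y ^ 2 - y * Ai y ^ 2) :=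
    antitone_of_deriv_nonpos (fun y => (hd y).differentiableAt) fun y => by
      rw [(hd y).deriv]; nlinarith [sq_nonneg (Ai y)]
  have := hm hax
  simp [hzero] at this
  nlinarith [sq_nonneg (Ai x)]

lemma Ai'_right (x : ℝ) (hx : 0 ≤ x) : deriv Ai x ^ 2 ≤ deriv Ai 0 ^ 2 := by
  have hd : ∀ y, HasDerivAt (fun y => deriv Ai y ^ 2) (2 * (y * (Ai y * deriv Ai y))) y := by
    intro y
    have := (Ai_deriv2 y).pow 2
    refine this.congr_deriv ?_
    simp; ring
  have hm : AntitoneOn (fun y => deriv Ai y ^ 2) (Ici 0) := by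
    refine antitoneOn_of_deriv_nonpos (convex_Ici 0)
      (fun y _ => (hd y).continuousAt.continuousWithinAt)
      (fun y _ => (hd y).differentiableAt.differentiableWithinAt) fun y hy => ?_
    rw [interior_Ici] at hy
    rw [(hd y).deriv]
    have := mul_nonpos_of_nonneg_of_nonpos (le_of_lt hy) (AiAi'_nonpos y (le_of_lt hy))
    linarith
  exact hm (show (0:ℝ) ∈ Ici 0 from self_mem_Ici) hx hx

/-- For every zero `a < 0` of `Ai` and every `x ≥ a`, one has `|Ai'(x)| ≤ |Ai'(a)|`: to the
right of any zero of `Ai`, `|Ai'|` is maximized at that zero. -/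
theorem airy_deriv_max_at_zero (a : ℝ) (ha : a < 0) (hzero : Ai a = 0) :
    ∀ x : ℝ, a ≤ x → |deriv Ai x| ≤ |deriv Ai a| := by
  intro x hx
  rw [← sq_le_sq]
  rcases le_total x 0 with h | h
  · exact Ai'_left a x hzero hx h
  · exact (Ai'_right x h).trans (Ai'_left a 0 hzero ha.le le_rfl)
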